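/- Let $\sigma>0$, $\beta>0$, and $x_0\in\mathbb{R}$, and set $w=\frac{x_0+i\beta}{\sqrt{2}\,\sigma}$. Then the cumulative distribution function of the Voigt profile satisfies $F(x_0;\sigma,\beta):=\int_{-\infty}^{x_0}V(x;\sigma,\beta)\,dx=\mathrm{Re}\left[\frac12+\frac{\mathrm{erf}(w)}{2}+\frac{i w^2}{\pi}\,{}_2F_2\!\left(1,1;\frac32,2;-w^2\right)\right]$. -/

import Mathlib

open Complex MeasureTheory Filter

noncomputable section

/-- Pochhammer symbol (a)_m = a(a+1)...(a+m-1). -/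
def poch (a : ℂ) (m : ℕ) : ℂ := ∏ i ∈ Finset.range m, (a + i)

/-- Confluent hypergeometric function ₁F₁(a;c;z). -/
def hyp1F1 (a c z : ℂ) : ℂ := ∑' m : ℕ, poch a m / (poch c m * (m.factorial : ℂ)) * z ^ m

/-- Humbert function Φ₃(a;c;x,y). -/
def Phi3 (a c x y : ℂ) : ℂ :=
  ∑' p : ℕ × ℕ,
    poch a p.1 / (poch c (p.1 + p.2) * (p.1.factorial : ℂ) * (p.2.factorial : ℂ))
      * x ^ p.1 * y ^ p.2

/-- Generalized hypergeometric function ₂F₂(a₁,a₂;b₁,b₂;z). -/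
def hyp2F2 (a₁ a₂ b₁ b₂ z : ℂ) : ℂ :=
  ∑' m : ℕ, poch a₁ m * poch a₂ m / (poch b₁ m * poch b₂ m * (m.factorial : ℂ)) * z ^ m

/-- Error function, extended to complex arguments along the segment from 0 to w. -/
def cerf (w : ℂ) : ℂ :=
  2 / (Real.sqrt Real.pi : ℂ) * ∫ t in (0:ℝ)..1, w * Complex.exp (-(((t:ℂ) * w) ^ 2))

/-- Imaginary error function, extended to complex arguments. -/
def cerfi (w : ℂ) : ℂ :=
  2 / (Real.sqrt Real.pi : ℂ) * ∫ t in (0:ℝ)..1, w * Complex.exp (((t:ℂ) * w) ^ 2)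

/-- Contour integral along the vertical line Re(s) = c : ∫_{(c)} f(s) ds. -/
def lineInt (c : ℝ) (f : ℂ → ℂ) : ℂ := Complex.I * ∫ t : ℝ, f (c + t * Complex.I)

/-- Generalized modified Bessel function K_{z,w}(x), defined with contour Re(s)=c. -/
def Kzw (z w x : ℂ) (c : ℝ) : ℂ :=
  (2 * (Real.pi : ℂ) * Complex.I)⁻¹ *
    lineInt c (fun s =>
      Complex.Gamma ((s - z) / 2) * Complex.Gamma ((s + z) / 2) *
        hyp1F1 ((s - z) / 2) (1/2) (-w^2 / 4) * hyp1F1 ((s + z) / 2) (1/2) (-w^2 / 4) *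
        (2:ℂ) ^ (s - 2) * x ^ (-s))

/-- Divisor function σ₋₁(n) = ∑_{d ∣ n} 1/d. -/
def sigmaNegOne (n : ℕ) : ℝ := ∑ d ∈ n.divisors, (d : ℝ)⁻¹

/-- Gaussian density. -/
def gauss (σ x : ℝ) : ℝ := Real.exp (-(x^2) / (2 * σ^2)) / (σ * Real.sqrt (2 * Real.pi))

/-- Lorentzian density. -/
def lorentz (β x : ℝ) : ℝ := β / (Real.pi * (x^2 + β^2))

/-- Voigt profile: convolution of Gaussian and Lorentzian. -/
def voigt (σ β x : ℝ) : ℝ := ∫ t : ℝ, gauss σ t * lorentz β (x - t)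

/-- Faddeeva function ξ(y) = e^{-y²}(1 - erf(-iy)). -/
def faddeeva (y : ℂ) : ℂ := Complex.exp (-y^2) * (1 - cerf (-Complex.I * y))


lemma gauss_eq_gaussianPDFReal {σ : ℝ} (hσ : 0 < σ) :
    gauss σ = ProbabilityTheory.gaussianPDFReal 0 (Real.toNNReal (σ ^ 2)) := by
  ext x
  have h : √(2 * Real.pi * σ ^ 2) = σ * √(2 * Real.pi) := by
    rw [Real.sqrt_mul (by positivity), Real.sqrt_sq hσ.le, mul_comm]
  simp only [gauss, ProbabilityTheory.gaussianPDFReal, Real.coe_toNNReal _ (sq_nonneg σ), h,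
    sub_zero]
  rw [div_eq_inv_mul]

lemma lorentz_eq_cauchyPDFReal {β : ℝ} (hβ : 0 < β) :
    lorentz β = ProbabilityTheory.cauchyPDFReal 0 (Real.toNNReal β) := by
  ext x
  simp only [lorentz, ProbabilityTheory.cauchyPDFReal, Real.coe_toNNReal _ hβ.le, sub_zero]
  rw [div_eq_mul_inv, mul_inv]
  ring

lemma integrable_gauss {σ : ℝ} (hσ : 0 < σ) : Integrable (gauss σ) := by
  rw [gauss_eq_gaussianPDFReal hσ]
  exact ProbabilityTheory.integrable_gaussianPDFReal _ _

lemma integral_gauss {σ : ℝ} (hσ : 0 < σ) : ∫ x, gauss σ x = 1 := by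
  rw [gauss_eq_gaussianPDFReal hσ]
  exact ProbabilityTheory.integral_gaussianPDFReal_eq_one _ (by simpa using hσ.ne')

lemma integral_gauss_mul_cexp {σ : ℝ} (hσ : 0 < σ) (s : ℝ) :
    ∫ t : ℝ, (gauss σ t : ℂ) * cexp (s * t * I) = cexp (-(σ ^ 2 * s ^ 2 / 2)) := by
  have hv : Real.toNNReal (σ ^ 2) ≠ 0 := by simpa using hσ.ne'
  have h := ProbabilityTheory.charFun_gaussianReal (μ := 0) (v := Real.toNNReal (σ ^ 2)) s
  rw [charFun_apply_real, ProbabilityTheory.integral_gaussianReal_eq_integral_smul hv,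
    ← gauss_eq_gaussianPDFReal hσ] at h
  simpa [Real.coe_toNNReal _ (sq_nonneg σ), neg_div] using h

lemma integrable_lorentz {β : ℝ} (hβ : 0 < β) : Integrable (lorentz β) := by
  rw [lorentz_eq_cauchyPDFReal hβ]
  exact ProbabilityTheory.integrable_cauchyPDFReal _

lemma integral_lorentz {β : ℝ} (hβ : 0 < β) : ∫ x, lorentz β x = 1 := by
  rw [lorentz_eq_cauchyPDFReal hβ]
  exact ProbabilityTheory.integral_cauchyPDFReal_eq_one _ (by simpa using hβ)

lemma voigt_eq_convolution (σ β : ℝ) :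
    voigt σ β = convolution (gauss σ) (lorentz β) (ContinuousLinearMap.mul ℝ ℝ) volume := rfl

lemma integrable_voigt {σ β : ℝ} (hσ : 0 < σ) (hβ : 0 < β) : Integrable (voigt σ β) := by
  rw [voigt_eq_convolution]
  exact (integrable_gauss hσ).integrable_convolution _ (integrable_lorentz hβ)

lemma integral_voigt {σ β : ℝ} (hσ : 0 < σ) (hβ : 0 < β) : ∫ x, voigt σ β x = 1 := by
  rw [voigt_eq_convolution, integral_convolution _ (integrable_gauss hσ) (integrable_lorentz hβ),
    integral_gauss hσ, integral_lorentz hβ]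
  simp

lemma voigt_neg (σ β x : ℝ) : voigt σ β (-x) = voigt σ β x := by
  unfold voigt
  rw [← integral_neg_eq_self]
  congr with t
  simp only [gauss, lorentz]
  ring_nf

lemma setIntegral_Iic_zero_voigt {σ β : ℝ} (hσ : 0 < σ) (hβ : 0 < β) :
    ∫ x in Set.Iic 0, voigt σ β x = 1 / 2 := by
  have h := integral_comp_neg_Iic 0 (voigt σ β)
  simp only [voigt_neg, neg_zero] at h
  have h' := intervalIntegral.integral_Iic_add_Ioi (b := (0 : ℝ))
    (integrable_voigt hσ hβ).integrableOn (integrable_voigt hσ hβ).integrableOn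
  rw [integral_voigt hσ hβ, ← h] at h'
  linarith

lemma setIntegral_Iic_voigt {σ β : ℝ} (hσ : 0 < σ) (hβ : 0 < β) (x₀ : ℝ) :
    ∫ x in Set.Iic x₀, voigt σ β x = 1 / 2 + ∫ x in (0 : ℝ)..x₀, voigt σ β x := by
  rw [← setIntegral_Iic_zero_voigt hσ hβ]
  have h := intervalIntegral.integral_Iic_sub_Iic (a := 0) (b := x₀)
    (integrable_voigt hσ hβ).integrableOn (integrable_voigt hσ hβ).integrableOn
  linarith

/-- The Voigt profile as the inverse Fourier transform of the product of the characteristic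
functions of the Gaussian and the Lorentzian. -/
lemma voigt_eq_re_integral {σ β : ℝ} (hσ : 0 < σ) (hβ : 0 < β) (x : ℝ) :
    voigt σ β x = (∫ s in Set.Ioi (0 : ℝ),
      cexp ((-β + x * I) * s) * cexp (-(σ ^ 2 * s ^ 2 / 2))).re / Real.pi := by
  let k : ℝ → ℝ → ℂ := fun t s => (gauss σ t : ℂ) * cexp ((-β + (x - t : ℝ) * I) * s)
  have hk : Integrable (Function.uncurry k) (volume.prod (volume.restrict (Set.Ioi 0))) := by
    have h := (integrable_gauss hσ).ofReal (𝕜 := ℂ) |>.mul_prod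
      (integrableOn_exp_mul_complex_Ioi (a := -β) (by simpa using hβ) 0)
    refine h.mono ?_ (Eventually.of_forall fun p => ?_)
    · refine Continuous.aestronglyMeasurable ?_
      simp only [k, Function.uncurry_def, gauss]
      fun_prop
    · simp [k, Function.uncurry_def, Complex.norm_exp]
  have hs : ∀ t, ∫ s in Set.Ioi (0 : ℝ), k t s
      = (gauss σ t : ℂ) * (-1 / (-β + (x - t : ℝ) * I)) := by
    intro t
    simp only [k]
    rw [integral_const_mul, integral_exp_mul_complex_Ioi (by simpa using hβ)]
    simp
  have ht : ∀ s : ℝ, ∫ t, k t s = cexp ((-β + x * I) * s) * cexp (-(σ ^ 2 * s ^ 2 / 2)) := by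
    intro s
    have h := integral_gauss_mul_cexp hσ (-s)
    have e : ∀ t : ℝ, k t s
        = cexp ((-β + x * I) * s) * ((gauss σ t : ℂ) * cexp ((-s : ℝ) * t * I)) := by
      intro t
      simp only [k]
      rw [mul_left_comm, ← Complex.exp_add]
      congr 2
      push_cast
      ring
    simp_rw [e]
    rw [integral_const_mul, h]
    simp
  have hswap := integral_integral_swap hk
  simp_rw [ht, hs] at hswap
  rw [← hswap]
  have hre := reCLM.integral_comp_comm (hk.integral_prod_left)
  simp only [Function.uncurry_def, hs, reCLM_apply] at hre
  rw [← hre, eq_div_iff Real.pi_ne_zero, voigt, ← integral_mul_const]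
  congr with t
  rw [re_ofReal_mul, mul_assoc]
  congr 1
  simp only [lorentz, Complex.div_re, Complex.normSq_apply]
  simp
  have : (x - t) ^ 2 + β ^ 2 ≠ 0 := by positivity
  have : β * β + (x - t) * (x - t) ≠ 0 :=
    (add_pos_of_pos_of_nonneg (mul_pos hβ hβ) (mul_self_nonneg _)).ne'
  field_simp
  ring

lemma intervalIntegral_voigt {σ β : ℝ} (hσ : 0 < σ) (hβ : 0 < β) (x₀ : ℝ) :
    ∫ x in (0 : ℝ)..x₀, voigt σ β x = (∫ s in Set.Ioi (0 : ℝ),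
      (cexp ((-β + x₀ * I) * s) - cexp (-β * s)) / (I * s)
        * cexp (-(σ ^ 2 * s ^ 2 / 2))).re / Real.pi := by
  let k : ℝ → ℝ → ℂ := fun x s => cexp ((-β + x * I) * s) * cexp (-(σ ^ 2 * s ^ 2 / 2))
  have hk : Integrable (Function.uncurry k)
      ((volume.restrict (Set.uIoc 0 x₀)).prod (volume.restrict (Set.Ioi 0))) := by
    have : IsFiniteMeasure (volume.restrict (Set.uIoc 0 x₀)) := by
      rw [Set.uIoc]
      infer_instance
    have h := (integrable_const (μ := volume.restrict (Set.uIoc 0 x₀)) (1 : ℂ)).mul_prod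
      (integrableOn_exp_mul_complex_Ioi (a := -β) (by simpa using hβ) 0)
    refine h.mono ?_ (Eventually.of_forall fun p => ?_)
    · refine Continuous.aestronglyMeasurable ?_
      simp only [k, Function.uncurry_def]
      fun_prop
    · have : ‖cexp (-(σ ^ 2 * p.2 ^ 2 / 2))‖ ≤ 1 := by
        rw [Complex.norm_exp, Real.exp_le_one_iff]
        norm_cast
        simp only [Left.neg_nonpos_iff]
        positivity
      simp only [k, Function.uncurry_def, norm_mul]
      refine (mul_le_of_le_one_right (norm_nonneg _) this).trans (le_of_eq ?_)
      simp [Complex.norm_exp]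
  have hint : IntervalIntegrable (fun x => ∫ s in Set.Ioi (0 : ℝ), k x s) volume 0 x₀ := by
    rw [intervalIntegrable_iff]
    exact hk.integral_prod_left
  have hre := reCLM.intervalIntegral_comp_comm hint
  simp only [reCLM_apply] at hre
  simp_rw [voigt_eq_re_integral hσ hβ]
  rw [intervalIntegral.integral_div, hre, intervalIntegral_integral_swap hk]
  congr 2
  refine setIntegral_congr_fun measurableSet_Ioi fun s (hs : 0 < s) => ?_
  have hs' : I * s ≠ 0 := by simp [hs.ne']
  simp only [k]
  rw [intervalIntegral.integral_mul_const]
  congr 1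
  have e : ∀ x : ℝ, cexp ((-β + x * I) * s) = cexp (-β * s) * cexp (I * s * x) := by
    intro x
    rw [← Complex.exp_add]
    ring_nf
  simp_rw [e]
  rw [intervalIntegral.integral_const_mul, integral_exp_mul_complex hs']
  simp
  ring

lemma integral_pow_mul_exp_neg_sq_div_four (n : ℕ) :
    ∫ s in Set.Ioi (0 : ℝ), s ^ n * Real.exp (-(s ^ 2 / 4))
      = 2 ^ n * Real.Gamma ((n + 1) / 2) := by
  have h := _root_.integral_rpow_mul_exp_neg_mul_rpow (p := 2) (q := n) (b := 1 / 4) (by norm_num)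
    (by linarith [n.cast_nonneg (α := ℝ)]) (by norm_num)
  have h4 : ((1 : ℝ) / 4) ^ (-((n : ℝ) + 1) / 2) = 2 ^ (n + 1) := by
    rw [show (1 : ℝ) / 4 = 2 ^ (-2 : ℝ) by rw [Real.rpow_neg (by norm_num)]; norm_num,
      ← Real.rpow_mul (by norm_num), ← Real.rpow_natCast]
    congr 1
    push_cast
    ring
  rw [h4] at h
  calc _ = ∫ s in Set.Ioi (0 : ℝ), s ^ (n : ℝ) * Real.exp (-(1 / 4) * s ^ (2 : ℝ)) := by
        congr with s
        rw [Real.rpow_natCast, Real.rpow_ofNat]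
        ring_nf
    _ = _ := by
        rw [h]
        ring

lemma integral_pow_even_mul_exp_neg_sq_div_four (m : ℕ) :
    ∫ s in Set.Ioi (0 : ℝ), s ^ (2 * m) * Real.exp (-(s ^ 2 / 4))
      = √Real.pi * (2 * m).factorial / m.factorial := by
  rw [integral_pow_mul_exp_neg_sq_div_four]
  have e : (((2 * m : ℕ) : ℝ) + 1) / 2 = m + 1 / 2 := by
    push_cast
    ring
  rw [e, pow_mul, eq_div_iff (by positivity)]
  clear e
  induction m with
  | zero => simpa using Real.Gamma_one_half_eq
  | succ m ih =>
    rw [show ((m + 1 : ℕ) : ℝ) + 1 / 2 = (m + 1 / 2) + 1 by push_cast; ring,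
      Real.Gamma_add_one (by positivity), show 2 * (m + 1) = 2 * m + 1 + 1 by ring]
    simp only [Nat.factorial_succ]
    push_cast
    linear_combination (2 * (m : ℝ) + 1) * (2 * m + 2) * ih

lemma integral_pow_odd_mul_exp_neg_sq_div_four (m : ℕ) :
    ∫ s in Set.Ioi (0 : ℝ), s ^ (2 * m + 1) * Real.exp (-(s ^ 2 / 4))
      = 2 ^ (2 * m + 1) * m.factorial := by
  rw [integral_pow_mul_exp_neg_sq_div_four]
  have e : (((2 * m + 1 : ℕ) : ℝ) + 1) / 2 = m + 1 := by
    push_cast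
    ring
  rw [e, Real.Gamma_nat_eq_factorial]

lemma hasSum_exp_mul_sub_one_div {a : ℂ} (ha : a ≠ 0) (z : ℂ) :
    HasSum (fun n : ℕ => a ^ n * z ^ (n + 1) / (n + 1).factorial) ((cexp (a * z) - 1) / a) := by
  have h := NormedSpace.expSeries_div_hasSum_exp (a * z)
  rw [← Complex.exp_eq_exp_ℂ, ← hasSum_nat_add_iff' 1] at h
  convert! h.div_const a using 1
  · ext n
    rw [mul_pow, pow_succ a]
    field_simp
  · simp

/-- Expansion of the Gaussian-weighted integral of `(exp (i z s) - 1) / (i s)` in powers of `z`. -/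
lemma hasSum_integral_exp_sub_one_div (z : ℂ) :
    HasSum (fun n : ℕ => I ^ n * z ^ (n + 1) / (n + 1).factorial
        * ((∫ s in Set.Ioi (0 : ℝ), s ^ n * Real.exp (-(s ^ 2 / 4)) : ℝ) : ℂ))
      (∫ s in Set.Ioi (0 : ℝ), (cexp (I * s * z) - 1) / (I * s) * cexp (-(s ^ 2 / 4))) := by
  have h : HasSum (fun n : ℕ => ∫ s in Set.Ioi (0 : ℝ), (I * s) ^ n * z ^ (n + 1)
        / (n + 1).factorial * cexp (-(s ^ 2 / 4)))
      (∫ s in Set.Ioi (0 : ℝ), (cexp (I * s * z) - 1) / (I * s) * cexp (-(s ^ 2 / 4))) := by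
    have hb : ∀ s : ℝ, HasSum
        (fun n : ℕ => (‖z‖ * s) ^ n / n.factorial * (‖z‖ * Real.exp (-(s ^ 2 / 4))))
        (Real.exp (‖z‖ * s) * (‖z‖ * Real.exp (-(s ^ 2 / 4)))) := by
      intro s
      refine HasSum.mul_right _ ?_
      rw [Real.exp_eq_exp_ℝ]
      exact NormedSpace.expSeries_div_hasSum_exp _
    refine hasSum_integral_of_dominated_convergence
      (fun n s => (‖z‖ * s) ^ n / n.factorial * (‖z‖ * Real.exp (-(s ^ 2 / 4))))
      (fun n => ?_) (fun n => ?_) ?_ ?_ ?_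
    · exact Continuous.aestronglyMeasurable (by fun_prop)
    · filter_upwards [ae_restrict_mem measurableSet_Ioi] with s hs
      have hs : 0 < s := hs
      have he : ‖cexp (-(s ^ 2 / 4))‖ = Real.exp (-(s ^ 2 / 4)) := by
        rw [Complex.norm_exp]
        norm_cast
      simp only [norm_mul, norm_div, norm_pow, norm_I, one_mul, Complex.norm_real,
        Real.norm_of_nonneg hs.le, he, Complex.norm_natCast]
      have : (n.factorial : ℝ) ≤ (n + 1).factorial := by
        exact_mod_cast Nat.factorial_le n.le_succ
      calc s ^ n * ‖z‖ ^ (n + 1) / (n + 1).factorial * Real.exp (-(s ^ 2 / 4))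
          ≤ s ^ n * ‖z‖ ^ (n + 1) / n.factorial * Real.exp (-(s ^ 2 / 4)) := by gcongr
        _ = _ := by ring
    · exact Eventually.of_forall fun s => (hb s).summable
    · simp_rw [fun s => (hb s).tsum_eq]
      have hq := ((integrable_cexp_quadratic (b := 1 / 4) (by norm_num) ‖z‖ 0).norm.mul_const
        ‖z‖).integrableOn (s := Set.Ioi 0)
      refine Integrable.congr hq (Eventually.of_forall fun s => ?_)
      have e : -(1 / 4) * (s : ℂ) ^ 2 + ‖z‖ * s + 0 = ((‖z‖ * s + -(s ^ 2 / 4) : ℝ) : ℂ) := by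
        push_cast
        ring
      simp only [e, Complex.norm_exp, ofReal_re, Real.exp_add]
      ring
    · filter_upwards [ae_restrict_mem measurableSet_Ioi] with s hs
      have hs : I * s ≠ 0 := by simpa using (ne_of_gt hs)
      exact (hasSum_exp_mul_sub_one_div hs z).mul_right _
  convert! h using 2 with n
  rw [← integral_complex_ofReal, ← integral_const_mul]
  congr with s
  push_cast
  ring

lemma hasSum_cerf (z : ℂ) :
    HasSum (fun m : ℕ => (-1) ^ m * z ^ (2 * m + 1) / ((2 * m + 1) * m.factorial))
      (√Real.pi / 2 * cerf z) := by
  have h : HasSum (fun m : ℕ => ∫ t in (0 : ℝ)..1, z * ((-((t * z) ^ 2)) ^ m / m.factorial))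
      (∫ t in (0 : ℝ)..1, z * cexp (-((t * z) ^ 2))) := by
    refine intervalIntegral.hasSum_integral_of_dominated_convergence
      (fun m _ => ‖z‖ * ((‖z‖ ^ 2) ^ m / m.factorial)) (fun m => ?_) (fun m => ?_) ?_ ?_ ?_
    · exact Continuous.aestronglyMeasurable (by fun_prop)
    · refine Eventually.of_forall fun t ht => ?_
      rw [Set.uIoc_of_le zero_le_one] at ht
      have : ‖(t * z)‖ ≤ ‖z‖ := by
        rw [norm_mul, Complex.norm_real, Real.norm_of_nonneg ht.1.le]
        exact mul_le_of_le_one_left (norm_nonneg _) ht.2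
      simp only [norm_mul z, norm_div, norm_pow, norm_neg, Complex.norm_natCast]
      gcongr
    · exact Eventually.of_forall fun t _ => (Real.summable_pow_div_factorial _).mul_left _
    · simp
    · refine Eventually.of_forall fun t _ => HasSum.mul_left _ ?_
      rw [Complex.exp_eq_exp_ℂ]
      exact NormedSpace.expSeries_div_hasSum_exp _
  convert! h using 1
  · ext m
    have e : ∀ t : ℝ, z * ((-((t * z) ^ 2)) ^ m / m.factorial)
        = (-1) ^ m * z ^ (2 * m + 1) / m.factorial * ((t ^ (2 * m) : ℝ) : ℂ) := by
      intro t
      rw [neg_pow, ← pow_mul, mul_pow, pow_succ]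
      push_cast
      ring
    simp_rw [e]
    rw [intervalIntegral.integral_const_mul, intervalIntegral.integral_ofReal, integral_pow]
    push_cast
    have : (2 * (m : ℂ) + 1) ≠ 0 := by norm_cast
    simp
    field_simp
  · rw [cerf]
    have : (√Real.pi : ℂ) ≠ 0 := by
      exact_mod_cast (Real.sqrt_pos.mpr Real.pi_pos).ne'
    field_simp

lemma poch_one (m : ℕ) : poch 1 m = m.factorial := by
  induction m with
  | zero => simp [poch]
  | succ m ih =>
    rw [poch, Finset.prod_range_succ, ← poch, ih, Nat.factorial_succ]
    push_cast
    ring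

lemma poch_two (m : ℕ) : poch 2 m = (m + 1).factorial := by
  induction m with
  | zero => simp [poch]
  | succ m ih =>
    rw [poch, Finset.prod_range_succ, ← poch, ih, Nat.factorial_succ (m + 1)]
    push_cast
    ring

lemma four_pow_mul_factorial_mul_poch (m : ℕ) :
    4 ^ m * m.factorial * poch (3 / 2) m = (2 * m + 1).factorial := by
  induction m with
  | zero => simp [poch]
  | succ m ih =>
    rw [poch, Finset.prod_range_succ, ← poch, show 2 * (m + 1) + 1 = 2 * m + 1 + 1 + 1 by ring]
    rw [Nat.factorial_succ (2 * m + 1 + 1), Nat.factorial_succ (2 * m + 1), Nat.factorial_succ m]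
    push_cast
    rw [← ih]
    ring

lemma poch_three_halves_ne_zero (m : ℕ) : poch (3 / 2) m ≠ 0 := by
  intro h
  have := four_pow_mul_factorial_mul_poch m
  rw [h, mul_zero] at this
  exact Nat.factorial_ne_zero _ (by exact_mod_cast this.symm)

lemma sq_mul_hyp2F2 (z : ℂ) :
    z ^ 2 * hyp2F2 1 1 (3 / 2) 2 (-z ^ 2)
      = ∑' m : ℕ, (-1) ^ m * z ^ (2 * m + 2) / (2 * m + 2).factorial
          * (2 ^ (2 * m + 1) * m.factorial) := by
  rw [hyp2F2, ← tsum_mul_left]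
  congr with m
  have h := four_pow_mul_factorial_mul_poch m
  have hp := poch_three_halves_ne_zero m
  have hf : (m.factorial : ℂ) ≠ 0 := by exact_mod_cast m.factorial_ne_zero
  have hm : (m : ℂ) + 1 ≠ 0 := by norm_cast
  rw [Nat.factorial_succ (2 * m + 1), poch_one, poch_two, Nat.factorial_succ m, neg_pow,
    ← pow_mul]
  push_cast
  rw [← h, pow_succ 2, pow_mul 2, show (2 : ℂ) ^ 2 = 4 by norm_num]
  rw [show (2 * (m : ℂ) + 1 + 1) = 2 * (m + 1) by ring]
  field_simp
  ring

/-- The Gaussian-weighted integral of `(exp (i z s) - 1) / (i s)` in closed form. -/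
lemma integral_exp_sub_one_div (z : ℂ) :
    ∫ s in Set.Ioi (0 : ℝ), (cexp (I * s * z) - 1) / (I * s) * cexp (-(s ^ 2 / 4))
      = Real.pi * (cerf z / 2) + I * z ^ 2 * hyp2F2 1 1 (3 / 2) 2 (-z ^ 2) := by
  have h := hasSum_integral_exp_sub_one_div z
  generalize hf : (fun n : ℕ => I ^ n * z ^ (n + 1) / (n + 1).factorial
    * ((∫ s in Set.Ioi (0 : ℝ), s ^ n * Real.exp (-(s ^ 2 / 4)) : ℝ) : ℂ)) = f at h
  have he : Function.Injective fun m : ℕ => 2 * m := mul_right_injective₀ two_ne_zero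
  have ho : Function.Injective fun m : ℕ => 2 * m + 1 := (add_left_injective 1).comp he
  have heven : ∑' m : ℕ, f (2 * m) = Real.pi * (cerf z / 2) := by
    have hpi : (√Real.pi : ℂ) * √Real.pi = Real.pi := by
      exact_mod_cast Real.mul_self_sqrt Real.pi_pos.le
    have hc : Real.pi * (cerf z / 2) = √Real.pi * (√Real.pi / 2 * cerf z) := by
      rw [← hpi]
      ring
    rw [hc, ← (hasSum_cerf z).tsum_eq, ← tsum_mul_left]
    refine tsum_congr fun m => ?_
    rw [← hf]
    beta_reduce
    rw [integral_pow_even_mul_exp_neg_sq_div_four, pow_mul, I_sq, Nat.factorial_succ]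
    push_cast
    have : ((2 * m).factorial : ℂ) ≠ 0 := by exact_mod_cast (2 * m).factorial_ne_zero
    field_simp
  have hodd : ∑' m : ℕ, f (2 * m + 1) = I * z ^ 2 * hyp2F2 1 1 (3 / 2) 2 (-z ^ 2) := by
    rw [mul_assoc, sq_mul_hyp2F2, ← tsum_mul_left]
    refine tsum_congr fun m => ?_
    rw [← hf]
    beta_reduce
    rw [integral_pow_odd_mul_exp_neg_sq_div_four, pow_succ I, pow_mul, I_sq]
    push_cast
    ring
  rw [← h.tsum_eq, ← tsum_even_add_odd (h.summable.comp_injective he)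
    (h.summable.comp_injective ho), heven, hodd]

lemma integrableOn_exp_sub_one_div {b : ℝ} (hb : 0 < b) (z : ℂ) :
    IntegrableOn (fun s : ℝ => (cexp (I * s * z) - 1) / (I * s) * cexp (-(b * s ^ 2)))
      (Set.Ioi 0) := by
  have hq := ((integrable_cexp_quadratic (b := b) (by simpa using hb) ‖z‖ 0).norm.const_mul
    ‖z‖).integrableOn (s := Set.Ioi 0)
  refine Integrable.mono' hq ?_ ?_
  · exact Measurable.aestronglyMeasurable (by fun_prop)
  · filter_upwards [ae_restrict_mem measurableSet_Ioi] with s hs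
    have hs : 0 < s := hs
    have hn : ‖I * s * z‖ = s * ‖z‖ := by simp [abs_of_pos hs]
    have h := Complex.norm_exp_sub_sum_le_norm_mul_exp (I * s * z) 1
    simp only [Finset.range_one, Finset.sum_singleton, pow_zero, Nat.factorial_zero, Nat.cast_one,
      div_one, pow_one, hn] at h
    have he : ‖cexp (-b * s ^ 2 + ‖z‖ * s + 0)‖
        = Real.exp (s * ‖z‖) * ‖cexp (-(b * s ^ 2))‖ := by
      rw [← Complex.norm_exp_ofReal, ← norm_mul, ← Complex.exp_add]
      congr 2
      push_cast
      ring
    rw [norm_mul, norm_div, he, ← mul_assoc]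
    gcongr
    rw [norm_mul, norm_I, one_mul, Complex.norm_real, Real.norm_of_nonneg hs.le,
      div_le_iff₀ hs]
    linarith

lemma intervalIntegral_voigt_eq_re_integral_exp_sub_one_div {σ β : ℝ} (hσ : 0 < σ) (hβ : 0 < β)
    (x₀ : ℝ) :
    ∫ x in (0 : ℝ)..x₀, voigt σ β x = (∫ s in Set.Ioi (0 : ℝ),
      (cexp (I * s * (x₀ + I * β)) - 1) / (I * s)
        * cexp (-((σ ^ 2 / 2 : ℝ) * s ^ 2))).re / Real.pi := by
  have hb : 0 < σ ^ 2 / 2 := by positivity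
  have hx := integrableOn_exp_sub_one_div hb (x₀ + I * β)
  have hi := integrableOn_exp_sub_one_div hb (I * β)
  have hI : ∀ s : ℝ, I * s * (I * β) = ((-β * s : ℝ) : ℂ) := by
    intro s
    push_cast
    linear_combination (s : ℂ) * β * I_mul_I
  have him : (∫ s in Set.Ioi (0 : ℝ),
      (cexp (I * s * (I * β)) - 1) / (I * s) * cexp (-((σ ^ 2 / 2 : ℝ) * s ^ 2))).re = 0 := by
    rw [← reCLM_apply, ← reCLM.integral_comp_comm hi]
    refine integral_eq_zero_of_ae (Eventually.of_forall fun s => ?_)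
    have : (cexp (I * s * (I * β)) - 1) / (I * s) * cexp (-((σ ^ 2 / 2 : ℝ) * s ^ 2))
        = (((Real.exp (-β * s) - 1) / s * Real.exp (-(σ ^ 2 / 2 * s ^ 2)) : ℝ) : ℂ) * -I := by
      rw [hI, div_mul_eq_div_div_swap, div_I]
      push_cast
      ring
    simp only [reCLM_apply, this, re_ofReal_mul]
    simp
  have hsub := congrArg re (integral_sub hx hi)
  rw [sub_re, him, sub_zero] at hsub
  rw [← hsub, intervalIntegral_voigt hσ hβ]
  congr 3 with s
  have e : I * s * (x₀ + I * β) = (-β + x₀ * I) * s := by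
    linear_combination (s : ℂ) * β * I_mul_I
  rw [hI, e]
  push_cast
  ring_nf

/-- the cumulative distribution function of the Voigt profile. -/
theorem voigt_cdf (σ β x₀ : ℝ) (hσ : 0 < σ) (hβ : 0 < β) :
    (∫ x in Set.Iic x₀, voigt σ β x)
      = (1/2 + cerf (((x₀:ℂ) + Complex.I * (β:ℂ)) / ((Real.sqrt 2 : ℂ) * (σ:ℂ))) / 2
          + Complex.I * (((x₀:ℂ) + Complex.I * (β:ℂ)) / ((Real.sqrt 2 : ℂ) * (σ:ℂ)))^2
              / (Real.pi : ℂ) *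
            hyp2F2 1 1 (3/2) 2
              (-(((x₀:ℂ) + Complex.I * (β:ℂ)) / ((Real.sqrt 2 : ℂ) * (σ:ℂ)))^2)).re := by

  have hc : 0 < √2 * σ := by positivity
  have hσ' : (σ : ℂ) ≠ 0 := by exact_mod_cast hσ.ne'
  have h2 : (√2 : ℂ) ^ 2 = 2 := by exact_mod_cast Real.sq_sqrt (zero_le_two (α := ℝ))
  set z : ℂ := ((x₀ : ℂ) + I * β) / (√2 * σ) with hz
  have hscale := integral_comp_mul_left_Ioi'
    (fun s : ℝ => (cexp (I * s * z) - 1) / (I * s) * cexp (-(s ^ 2 / 4))) 0 hc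
  rw [mul_zero, integral_exp_sub_one_div, ← integral_smul] at hscale
  have hpi : (Real.pi : ℂ) ≠ 0 := by exact_mod_cast Real.pi_ne_zero
  have hrhs : 1 / 2 + cerf z / 2 + I * z ^ 2 / Real.pi * hyp2F2 1 1 (3 / 2) 2 (-z ^ 2)
      = 1 / 2 + (Real.pi * (cerf z / 2) + I * z ^ 2 * hyp2F2 1 1 (3 / 2) 2 (-z ^ 2))
          / Real.pi := by
    field_simp
    ring
  rw [hrhs, ← hscale, setIntegral_Iic_voigt hσ hβ,
    intervalIntegral_voigt_eq_re_integral_exp_sub_one_div hσ hβ, add_re, div_ofReal_re]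
  congr 1
  · simp
  congr 2
  refine setIntegral_congr_fun measurableSet_Ioi fun s (hs : 0 < s) => ?_
  have hs' : (s : ℂ) ≠ 0 := by exact_mod_cast hs.ne'
  have e₁ : I * ((√2 * σ * s : ℝ) : ℂ) * z = I * s * (x₀ + I * β) := by
    rw [hz]
    push_cast
    field_simp
  have e₂ : -(((√2 * σ * s : ℝ) : ℂ) ^ 2 / 4) = -((σ ^ 2 / 2 : ℝ) * s ^ 2) := by
    push_cast
    rw [mul_pow, mul_pow, h2]
    ring
  simp only [e₁, e₂, real_smul]
  push_cast
  field_simp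

end
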